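/- Let the additive group ℤ of integers act trivially on the right on a pointed set S, pointed at pt. Then the reduced universal monoid U[S//ℤ] of the pointed action category S//ℤ is isomorphic, as a monoid, to the free group on the set of elements of S other than pt (that is, to the reduced free group F[S]). -/

import Mathlib

open CategoryTheory

/-- A right action of a monoid `M` on a type `X`. -/
class RightAction (M X : Type) [Monoid M] where
  act : X → M → X
  act_one : ∀ x : X, act x 1 = x
  act_mul : ∀ (x : X) (m k : M), act (act x m) k = act x (m * k)

/-- The action category `X // M` of a right action of a monoid `M` on `X`:
objects are the elements of `X`, and a morphism `x ⟶ y` is an element `m : M`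
with `y = x · m`. -/
structure ActionCat (M X : Type) [Monoid M] [RightAction M X] where
  obj : X

instance (M X : Type) [Monoid M] [RightAction M X] : Category (ActionCat M X) where
  Hom a b := { m : M // RightAction.act a.obj m = b.obj }
  id a := ⟨1, RightAction.act_one a.obj⟩
  comp f g := ⟨f.1 * g.1, by rw [← RightAction.act_mul, f.2, g.2]⟩
  id_comp f := Subtype.ext (one_mul _)
  comp_id f := Subtype.ext (mul_one _)
  assoc f g h := Subtype.ext (mul_assoc _ _ _)



/-- The set of all morphisms of a small category `C`. -/
abbrev Mor (C : Type) [SmallCategory C] : Type := Σ x y : C, x ⟶ y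

/-- The generating relations for the universal monoid `U(C)` on a small category `C`:
the identity `id_x` of each object is related to `1`, and the composite `g ∘ f` of a
composable pair `f : x → y`, `g : y → z` is related to the product `f·g`. -/
def uRel (C : Type) [SmallCategory C] :
    FreeMonoid (Mor C) → FreeMonoid (Mor C) → Prop := fun a b =>
  (∃ x : C, a = FreeMonoid.of ⟨x, x, 𝟙 x⟩ ∧ b = 1) ∨
  (∃ (x y z : C) (f : x ⟶ y) (g : y ⟶ z),
    a = FreeMonoid.of ⟨x, z, f ≫ g⟩ ∧
    b = FreeMonoid.of ⟨x, y, f⟩ * FreeMonoid.of ⟨y, z, g⟩)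

/-- The universal monoid `U(C)` of a small category `C`: the quotient of the free
monoid on the set of all morphisms of `C` by the monoid congruence generated by the
relations `id_x ~ 1` and `(g ∘ f) ~ f·g`. -/
abbrev UMon (C : Type) [SmallCategory C] : Type := (conGen (uRel C)).Quotient

/-- The class `⟦f⟧` in `U(C)` of a morphism `f` of `C`. -/
def UMon.mk {C : Type} [SmallCategory C] {x y : C} (f : x ⟶ y) : UMon C :=
  (conGen (uRel C)).mk' (FreeMonoid.of ⟨x, y, f⟩)

/-- The generating relations for the reduced universal monoid `U[C]` of a pointed
category `(C, pt)`: in addition to the relations of `U(C)`, every endomorphism of the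
basepoint `pt` is related to `1`. -/
def uRedRel (C : Type) [SmallCategory C] (pt : C) :
    FreeMonoid (Mor C) → FreeMonoid (Mor C) → Prop := fun a b =>
  uRel C a b ∨ (∃ e : pt ⟶ pt, a = FreeMonoid.of ⟨pt, pt, e⟩ ∧ b = 1)

/-- The reduced universal monoid `U[C]` of a pointed category `(C, pt)`: the quotient
of the free monoid on the morphisms of `C` by the monoid congruence generated by the
relations `id_x ~ 1`, `(g ∘ f) ~ f·g`, and `e ~ 1` for every endomorphism `e` of `pt`. -/
abbrev URed (C : Type) [SmallCategory C] (pt : C) : Type := (conGen (uRedRel C pt)).Quotient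

/-- The class `⟦f⟧` in `U[C]` of a morphism `f` of `C`. -/
def URed.mk {C : Type} [SmallCategory C] (pt : C) {x y : C} (f : x ⟶ y) : URed C pt :=
  (conGen (uRedRel C pt)).mk' (FreeMonoid.of ⟨x, y, f⟩)

namespace URed

variable {C : Type} [SmallCategory C]

theorem mk_id (pt x : C) : URed.mk pt (𝟙 x) = 1 :=
  (Con.eq _).2 (ConGen.Rel.of _ _ (Or.inl (Or.inl ⟨x, rfl, rfl⟩)))

theorem mk_comp (pt : C) {x y z : C} (f : x ⟶ y) (g : y ⟶ z) :
    URed.mk pt (f ≫ g) = URed.mk pt f * URed.mk pt g :=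
  (Con.eq _).2 (ConGen.Rel.of _ _ (Or.inl (Or.inr ⟨x, y, z, f, g, rfl, rfl⟩)))

theorem mk_basepoint (pt : C) (e : pt ⟶ pt) : URed.mk pt e = 1 :=
  (Con.eq _).2 (ConGen.Rel.of _ _ (Or.inr ⟨e, rfl, rfl⟩))

/-- The universal property of `U[C]`: a functorial assignment of elements of a monoid `N` to the
morphisms of `C`, trivial on the endomorphisms of `pt`, extends to `U[C]`. -/
def lift (pt : C) {N : Type} [Monoid N] (φ : ∀ {x y : C}, (x ⟶ y) → N)
    (map_id : ∀ x : C, φ (𝟙 x) = 1)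
    (map_comp : ∀ {x y z : C} (f : x ⟶ y) (g : y ⟶ z), φ (f ≫ g) = φ f * φ g)
    (map_basepoint : ∀ e : pt ⟶ pt, φ e = 1) : URed C pt →* N :=
  (conGen (uRedRel C pt)).lift (FreeMonoid.lift fun f : Mor C => φ f.2.2) <| by
    refine Con.conGen_le.2 ?_
    rintro _ _ ((⟨x, rfl, rfl⟩ | ⟨x, y, z, f, g, rfl, rfl⟩) | ⟨e, rfl, rfl⟩)
    · simpa [Con.ker_rel] using map_id x
    · simpa [Con.ker_rel] using map_comp f g
    · simpa [Con.ker_rel] using map_basepoint e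

theorem hom_ext {pt : C} {N : Type} [Monoid N] {F G : URed C pt →* N}
    (h : ∀ {x y : C} (f : x ⟶ y), F (URed.mk pt f) = G (URed.mk pt f)) : F = G :=
  Con.hom_ext (FreeMonoid.hom_eq fun f => h f.2.2)

end URed

namespace ActionCat

variable {M S : Type} [Monoid M] [RightAction M S]

/-- The endomorphism of `s` in the action category of a trivial action given by `m`. -/
def loop (htriv : ∀ (s : S) (m : M), RightAction.act s m = s) (s : S) (m : M) :
    (⟨s⟩ : ActionCat M S) ⟶ ⟨s⟩ :=
  ⟨m, htriv s m⟩

/-- The class in `U[S // M]` of the endomorphisms of `s`, for a trivial action. -/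
def loopHom (htriv : ∀ (s : S) (m : M), RightAction.act s m = s) (pt s : S) :
    M →* URed (ActionCat M S) ⟨pt⟩ where
  toFun m := URed.mk _ (loop htriv s m)
  map_one' := URed.mk_id _ _
  map_mul' m k := URed.mk_comp _ (loop htriv s m) (loop htriv s k)

theorem loopHom_of_eq (htriv : ∀ (s : S) (m : M), RightAction.act s m = s) {pt s : S}
    (h : s = pt) (m : M) : loopHom htriv pt s m = 1 := by
  subst h
  exact URed.mk_basepoint _ _

theorem mk_eq_loopHom (htriv : ∀ (s : S) (m : M), RightAction.act s m = s) (pt : S)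
    {x y : ActionCat M S} (f : x ⟶ y) : URed.mk ⟨pt⟩ f = loopHom htriv pt x.obj f.1 := by
  obtain ⟨x⟩ := x
  obtain ⟨y⟩ := y
  obtain ⟨m, hm⟩ := f
  obtain rfl : x = y := (htriv x m).symm.trans hm
  rfl

end ActionCat

open Classical in
/-- The generator of the free group on `S` minus `pt` given by `s`, or `1` if `s` is `pt`. -/
noncomputable def reducedGenerator {S : Type} (pt s : S) : FreeGroup {s : S // s ≠ pt} :=
  if h : s = pt then 1 else FreeGroup.of ⟨s, h⟩

theorem reducedGenerator_of_eq {S : Type} {pt s : S} (h : s = pt) : reducedGenerator pt s = 1 :=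
  dif_pos h

theorem reducedGenerator_of_ne {S : Type} {pt s : S} (h : s ≠ pt) :
    reducedGenerator pt s = FreeGroup.of ⟨s, h⟩ :=
  dif_neg h

section IntTrivialAction

variable {S : Type} [RightAction (Multiplicative ℤ) S]

/-- The homomorphism from `U[S // ℤ]` to the reduced free group sending the endomorphism `n` of
`s` to the `n`-th power of `s`. -/
noncomputable def uRedToFreeGroup
    (htriv : ∀ (s : S) (m : Multiplicative ℤ), RightAction.act s m = s) (pt : S) :
    URed (ActionCat (Multiplicative ℤ) S) ⟨pt⟩ →* FreeGroup {s : S // s ≠ pt} :=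
  URed.lift _ (fun {x _} f => reducedGenerator pt x.obj ^ f.1.toAdd)
    (fun _ => zpow_zero _)
    (fun {x y _} f g => by
      have hxy : x.obj = y.obj := (htriv x.obj f.1).symm.trans f.2
      rw [← congrArg (reducedGenerator pt) hxy]
      exact zpow_add _ _ _)
    (fun e => by rw [reducedGenerator_of_eq rfl, one_zpow])

theorem uRedToFreeGroup_mk
    (htriv : ∀ (s : S) (m : Multiplicative ℤ), RightAction.act s m = s) (pt : S)
    {x y : ActionCat (Multiplicative ℤ) S} (f : x ⟶ y) :
    uRedToFreeGroup htriv pt (URed.mk ⟨pt⟩ f) = reducedGenerator pt x.obj ^ f.1.toAdd :=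
  rfl

/-- The homomorphism from the reduced free group to `U[S // ℤ]` sending `s` to the endomorphism
`1` of `s`. -/
def freeGroupToURed
    (htriv : ∀ (s : S) (m : Multiplicative ℤ), RightAction.act s m = s) (pt : S) :
    FreeGroup {s : S // s ≠ pt} →* URed (ActionCat (Multiplicative ℤ) S) ⟨pt⟩ :=
  (Units.coeHom _).comp <| FreeGroup.lift fun s =>
    (ActionCat.loopHom htriv pt s.1).toHomUnits (Multiplicative.ofAdd 1)

theorem freeGroupToURed_of_zpow
    (htriv : ∀ (s : S) (m : Multiplicative ℤ), RightAction.act s m = s) (pt : S)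
    (s : {s : S // s ≠ pt}) (n : ℤ) :
    freeGroupToURed htriv pt (FreeGroup.of s ^ n) =
      ActionCat.loopHom htriv pt s.1 (Multiplicative.ofAdd n) := by
  rw [freeGroupToURed, MonoidHom.comp_apply, map_zpow, FreeGroup.lift_apply_of, ← map_zpow, ← ofAdd_zsmul, smul_eq_mul, mul_one]
  rfl

end IntTrivialAction

/-- Let the additive group `ℤ` of integers (written multiplicatively as
`Multiplicative ℤ`) act trivially on the right on a pointed type `S`, pointed at `pt`.
Then the reduced universal monoid `U[S // ℤ]` of the pointed action category `S // ℤ`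
is isomorphic, as a monoid, to the free group on the set of elements of `S` other than
`pt` (that is, to the reduced free group `F[S]`, viewed as a monoid). -/
theorem uRed_int_trivialAction_iso_freeGroup (S : Type)
    [RightAction (Multiplicative ℤ) S]
    (htriv : ∀ (s : S) (m : Multiplicative ℤ), RightAction.act s m = s) (pt : S) :
    Nonempty (URed (ActionCat (Multiplicative ℤ) S) ⟨pt⟩ ≃*
      FreeGroup {s : S // s ≠ pt}) := by
  refine ⟨MonoidHom.toMulEquiv (uRedToFreeGroup htriv pt) (freeGroupToURed htriv pt) ?_ ?_⟩
  · refine URed.hom_ext fun {x y} f => ?_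
    rw [MonoidHom.comp_apply, uRedToFreeGroup_mk, MonoidHom.id_apply,
      ActionCat.mk_eq_loopHom htriv pt f]
    by_cases h : x.obj = pt
    · rw [reducedGenerator_of_eq h, one_zpow, map_one, ActionCat.loopHom_of_eq htriv h]
    · rw [reducedGenerator_of_ne h, freeGroupToURed_of_zpow, ofAdd_toAdd]
  · refine FreeGroup.ext_hom _ _ fun s => ?_
    rw [MonoidHom.comp_apply, MonoidHom.id_apply, ← zpow_one (FreeGroup.of s),
      freeGroupToURed_of_zpow, ← reducedGenerator_of_ne s.2]
    rfl
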